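/- In R = MvPolynomial (Fin 8) ℤ, the second elementary symmetric function of the multiset W((2,2,2,2,2,1,1), 8) of weights of semistandard Young tableaux of shape (2,2,2,2,2,1,1) with entries in {0,…,7} is congruent to 156·e₂ modulo the ideal generated by e₁; equivalently, c₂(γ₈^{(2,2,2,2,2,1,1)}) = 156·c₂(γ₈), the Table 1 entry for the weight α₅+α₇ of SL₈/μ₂. -/

import Mathlib

open MvPolynomial

open scoped Classical in
/-- The multiset `W(lam, n)` of weights of semistandard Young tableaux of shape
`lam` (a list of row lengths) with entries in `{0, …, n-1}`: a tableau assigns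
to each cell `(i, j)` of the Young diagram of `lam` an entry in `Fin n`, weakly
increasing along rows and strictly increasing down columns; its weight is the
sum `∑_{(i,j) ∈ lam} X_{T(i,j)}`. -/
noncomputable def ssytWeights (lam : List ℕ) (n : ℕ) :
    Multiset (MvPolynomial (Fin n) ℤ) :=
  ((Finset.univ : Finset ((i : Fin lam.length) → Fin (lam.get i) → Fin n)).filter
      (fun T =>
        (∀ (i : Fin lam.length) (j j' : Fin (lam.get i)), (j : ℕ) ≤ (j' : ℕ) → T i j ≤ T i j') ∧
        (∀ (i i' : Fin lam.length), (i : ℕ) < (i' : ℕ) →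
          ∀ (j : Fin (lam.get i')) (hj : (j : ℕ) < lam.get i), T i ⟨j, hj⟩ < T i' j))).val.map
    (fun T => ∑ i, ∑ j, MvPolynomial.X (T i j))

/-- Twice the second elementary symmetric function is the square of the sum minus the sum of
the squares. -/
theorem Multiset.two_mul_esymm_two {R : Type*} [CommRing R] (s : Multiset R) :
    2 * s.esymm 2 = s.sum ^ 2 - (s.map (· ^ 2)).sum := by
  induction s using Multiset.induction_on with
  | empty => simp [Multiset.esymm, Multiset.powersetCard_zero_right]
  | cons a s ih =>
    have h : (a ::ₘ s).esymm 2 = s.esymm 2 + a * s.sum := by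
      simp [Multiset.esymm, Multiset.powersetCard_cons, Multiset.powersetCard_one,
        Multiset.map_map]
      simpa using Multiset.sum_map_mul_left (s := s) (a := a) (f := id)
    rw [h, mul_add, ih]
    simp
    ring

/-- A list of elements of `Fin n` is strictly increasing iff it is a sublist of
`List.finRange n`. -/
theorem List.sublist_finRange_iff {n : ℕ} (l : List (Fin n)) :
    l.Sublist (List.finRange n) ↔ l.Pairwise (· < ·) := by
  have hs : (List.finRange n).Pairwise (· < ·) := List.pairwise_lt_finRange n
  refine ⟨fun h => hs.sublist h, fun h => ?_⟩
  refine List.sublist_of_subperm_of_pairwise (r := (· < ·)) ?_ h hs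
  exact (List.subperm_of_subset (h.imp fun h => ne_of_lt h) fun x _ => List.mem_finRange x)

namespace TwoColumnTableau

/-- The shape with columns of heights `7` and `5`. -/
abbrev shape : List ℕ := [2, 2, 2, 2, 2, 1, 1]

/-- Fillings of `shape` with entries in `Fin 8`. -/
abbrev Filling : Type := (i : Fin shape.length) → Fin (shape.get i) → Fin 8

theorem zero_lt_get (i : Fin 7) : 0 < shape.get i := by
  revert i; decide

theorem one_lt_get (i : Fin 5) : 1 < shape.get (Fin.castLE (by decide) i) := by
  revert i; decide

/-- The first column of a filling. -/
def fstCol (T : Filling) (i : Fin 7) : Fin 8 := T i ⟨0, zero_lt_get i⟩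

/-- The second column of a filling. -/
def sndCol (T : Filling) (i : Fin 5) : Fin 8 := T (Fin.castLE (by decide) i) ⟨1, one_lt_get i⟩

/-- The filling with prescribed columns. -/
def ofCols (f : Fin 7 → Fin 8) (g : Fin 5 → Fin 8) : Filling := fun i j =>
  if (j : ℕ) = 0 then f i else if h : (i : ℕ) < 5 then g ⟨i, h⟩ else 0

theorem cell_cases (i : Fin shape.length) (j : Fin (shape.get i)) :
    (j : ℕ) = 0 ∨ (j : ℕ) = 1 ∧ (i : ℕ) < 5 := by
  revert i; decide

theorem fstCol_ofCols (f : Fin 7 → Fin 8) (g : Fin 5 → Fin 8) : fstCol (ofCols f g) = f := by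
  funext i; simp [fstCol, ofCols]

theorem sndCol_ofCols (f : Fin 7 → Fin 8) (g : Fin 5 → Fin 8) : sndCol (ofCols f g) = g := by
  funext i; simp [sndCol, ofCols]

theorem filling_ext {T T' : Filling} (h₀ : fstCol T = fstCol T') (h₁ : sndCol T = sndCol T') :
    T = T' := by
  funext i j
  obtain ⟨j, hj⟩ := j
  rcases cell_cases i ⟨j, hj⟩ with h | ⟨h, hi⟩ <;> dsimp only at h <;> subst h
  · exact congrFun h₀ i
  · exact congrFun h₁ ⟨i, hi⟩

/-- A filling of `shape` is semistandard. -/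
def IsSemistandard (T : Filling) : Prop :=
  (∀ (i : Fin shape.length) (j j' : Fin (shape.get i)), (j : ℕ) ≤ (j' : ℕ) → T i j ≤ T i j') ∧
    (∀ (i i' : Fin shape.length), (i : ℕ) < (i' : ℕ) →
      ∀ (j : Fin (shape.get i')) (hj : (j : ℕ) < shape.get i), T i ⟨j, hj⟩ < T i' j)

theorem isSemistandard_iff (T : Filling) :
    IsSemistandard T ↔ (∀ i : Fin 5, fstCol T (Fin.castLE (by decide) i) ≤ sndCol T i) ∧
      StrictMono (fstCol T) ∧ StrictMono (sndCol T) := by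
  constructor
  · rintro ⟨hr, hc⟩
    exact ⟨fun i => hr _ _ _ (Nat.zero_le 1), fun i i' h => hc i i' h ⟨0, zero_lt_get i'⟩ _,
      fun i i' h => hc _ _ h ⟨1, one_lt_get i'⟩ _⟩
  · rintro ⟨hr, h₀, h₁⟩
    constructor
    · rintro i ⟨j, hj⟩ ⟨j', hj'⟩ h
      rcases cell_cases i ⟨j, hj⟩ with e | ⟨e, hi⟩ <;>
      rcases cell_cases i ⟨j', hj'⟩ with e' | ⟨e', hi'⟩ <;>
      dsimp only at e e' h <;> subst e <;> subst e'
      · exact le_rfl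
      · exact hr ⟨i, hi'⟩
      · omega
      · exact le_rfl
    · rintro i i' h ⟨j, hj⟩ hj'
      rcases cell_cases i' ⟨j, hj⟩ with e | ⟨e, hi⟩ <;> dsimp only at e <;> subst e
      · exact h₀ h
      · exact h₁ (a := ⟨i, h.trans hi⟩) (b := ⟨i', hi⟩) h

/-- The columns of a filling, as lists. -/
def cols (T : Filling) : List (Fin 8) × List (Fin 8) :=
  (List.ofFn (fstCol T), List.ofFn (sndCol T))

theorem cols_injective : Function.Injective cols := fun _ _ h =>
  filling_ext (List.ofFn_injective (congrArg Prod.fst h))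
    (List.ofFn_injective (congrArg Prod.snd h))

/-- The pairs of columns of the semistandard tableaux of shape `shape`. -/
def colsList : List (List (Fin 8) × List (Fin 8)) :=
  ((List.sublistsLen 7 (List.finRange 8)).product (List.sublistsLen 5 (List.finRange 8))).filter
    fun p => (p.1.zip p.2).all fun q => decide (q.1 ≤ q.2)

theorem nodup_colsList : colsList.Nodup :=
  ((List.nodup_sublistsLen _ (List.nodup_finRange 8)).product
    (List.nodup_sublistsLen _ (List.nodup_finRange 8))).filter _

theorem ofFn_mem_sublistsLen_iff {m n : ℕ} (f : Fin m → Fin n) :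
    List.ofFn f ∈ List.sublistsLen m (List.finRange n) ↔ StrictMono f := by
  rw [List.mem_sublistsLen, List.sublist_finRange_iff, List.pairwise_ofFn]
  simp [StrictMono]

theorem cols_mem_colsList_iff (T : Filling) : cols T ∈ colsList ↔ IsSemistandard T := by
  have hz : ((List.ofFn (fstCol T)).zip (List.ofFn (sndCol T))).all
      (fun q => decide (q.1 ≤ q.2)) = true ↔
      ∀ i : Fin 5, fstCol T (Fin.castLE (by decide) i) ≤ sndCol T i := by
    simp [List.ofFn_succ, Fin.forall_fin_succ]
  rw [isSemistandard_iff, colsList, List.mem_filter, cols, List.pair_mem_product,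
    ofFn_mem_sublistsLen_iff, ofFn_mem_sublistsLen_iff, hz]
  tauto

theorem exists_cols_eq {p : List (Fin 8) × List (Fin 8)} (hp : p ∈ colsList) :
    ∃ T, cols T = p := by
  obtain ⟨l, m⟩ := p
  rw [colsList, List.mem_filter, List.pair_mem_product, List.mem_sublistsLen,
    List.mem_sublistsLen] at hp
  obtain ⟨⟨⟨-, hl⟩, -, hm⟩, -⟩ := hp
  refine ⟨ofCols (fun i => l.get (i.cast hl.symm)) (fun i => m.get (i.cast hm.symm)), ?_⟩
  rw [cols, fstCol_ofCols, sndCol_ofCols]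
  exact Prod.ext (List.ext_getElem (by simp [hl]) fun n _ _ => by rw [List.getElem_ofFn]; rfl)
    (List.ext_getElem (by simp [hm]) fun n _ _ => by rw [List.getElem_ofFn]; rfl)

/-- The multiplicity of an entry in a pair of columns. -/
def mult (p : List (Fin 8) × List (Fin 8)) (v : Fin 8) : ℕ := p.1.count v + p.2.count v

theorem sum_map_X (l : List (Fin 8)) :
    (l.map (X : Fin 8 → MvPolynomial (Fin 8) ℤ)).sum =
      ∑ v, (l.count v : MvPolynomial (Fin 8) ℤ) * X v := by
  induction l with
  | nil => simp
  | cons a l ih =>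
    simp [ih, List.count_cons, add_mul, Finset.sum_add_distrib, add_comm]

theorem sum_eq_sum_mult (T : Filling) :
    (∑ i, ∑ j, X (T i j) : MvPolynomial (Fin 8) ℤ) =
      ∑ v, (mult (cols T) v : MvPolynomial (Fin 8) ℤ) * X v := by
  simp only [mult, cols, Nat.cast_add, add_mul, Finset.sum_add_distrib, ← sum_map_X]
  have h : (∑ i, ∑ j, X (T i j) : MvPolynomial (Fin 8) ℤ) =
      (∑ i : Fin 7, X (fstCol T i)) + ∑ i : Fin 5, X (sndCol T i) := by
    rw [Fin.sum_univ_seven, Fin.sum_univ_five]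
    change ∑ i : Fin 7, _ = _
    rw [Fin.sum_univ_seven]
    trans (∑ j : Fin 2, X (T 0 j)) + (∑ j : Fin 2, X (T 1 j)) + (∑ j : Fin 2, X (T 2 j)) +
      (∑ j : Fin 2, X (T 3 j)) + (∑ j : Fin 2, X (T 4 j)) + (∑ j : Fin 1, X (T 5 j)) +
      ∑ j : Fin 1, X (T 6 j)
    · rfl
    simp only [Fin.sum_univ_two, Fin.sum_univ_one]
    trans (X (fstCol T 0) + X (sndCol T 0)) + (X (fstCol T 1) + X (sndCol T 1)) +
      (X (fstCol T 2) + X (sndCol T 2)) + (X (fstCol T 3) + X (sndCol T 3)) +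
      (X (fstCol T 4) + X (sndCol T 4)) + X (fstCol T 5) + X (fstCol T 6)
    · rfl
    ring
  rw [h, List.map_ofFn, List.map_ofFn, List.sum_ofFn, List.sum_ofFn]
  rfl

theorem ssytWeights_eq : ssytWeights shape 8 =
    (colsList : Multiset _).map fun p => ∑ v, (mult p v : MvPolynomial (Fin 8) ℤ) * X v := by
  classical
  have h : ((Finset.univ : Finset Filling).filter IsSemistandard).val.map cols =
      (colsList : Multiset _) := by
    refine (Multiset.Nodup.ext ((Finset.nodup _).map cols_injective)
      (Multiset.coe_nodup.2 nodup_colsList)).2 fun p => ?_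
    simp only [Multiset.mem_map, Finset.mem_val, Finset.mem_filter, Finset.mem_univ, true_and,
      Multiset.mem_coe]
    constructor
    · rintro ⟨T, hT, rfl⟩
      exact (cols_mem_colsList_iff T).2 hT
    · intro hp
      obtain ⟨T, rfl⟩ := exists_cols_eq hp
      exact ⟨T, (cols_mem_colsList_iff T).1 hp, rfl⟩
  rw [← h, Multiset.map_map, ssytWeights]
  refine (Multiset.map_congr ?_ fun T _ => sum_eq_sum_mult T)
  unfold IsSemistandard
  congr!

theorem sum_mult (v : Fin 8) : (colsList.map fun p => mult p v).sum = 567 := by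
  revert v; decide +kernel

theorem sum_mult_mul_mult (u v : Fin 8) :
    (colsList.map fun p => mult p u * mult p v).sum = if u = v then 987 else 831 := by
  revert u v; decide +kernel

theorem sum_map_linear {α ι R : Type*} [Fintype ι] [CommSemiring R] (L : List α) (m : α → ι → ℕ)
    (x : ι → R) :
    (L.map fun p => ∑ v, (m p v : R) * x v).sum =
      ∑ v, (((L.map fun p => m p v).sum : ℕ) : R) * x v := by
  induction L with
  | nil => simp
  | cons a L ih => simp [ih, add_mul, Finset.sum_add_distrib]

theorem sum_map_linear_sq {α ι R : Type*} [Fintype ι] [CommSemiring R] (L : List α)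
    (m : α → ι → ℕ) (x : ι → R) :
    (L.map fun p => (∑ v, (m p v : R) * x v) ^ 2).sum =
      ∑ u, ∑ v, (((L.map fun p => m p u * m p v).sum : ℕ) : R) * (x u * x v) := by
  induction L with
  | nil => simp
  | cons a L ih =>
    simp only [List.map_cons, List.sum_cons, ih, Nat.cast_add, add_mul, Finset.sum_add_distrib]
    simp only [sq, Finset.sum_mul_sum, Nat.cast_mul, mul_mul_mul_comm]

end TwoColumnTableau

open TwoColumnTableau in
/-- `c₂(γ8^[2, 2, 2, 2, 2, 1, 1]) = 156·c₂(γ8)`: the second elementary symmetric function of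
the multiset of weights of semistandard Young tableaux of shape `[2, 2, 2, 2, 2, 1, 1]` with
entries in `{0, …, 7}` is congruent to `156·e₂` modulo the ideal generated
by `e₁`. -/
theorem c2_ssyt_stmt12 :
    Multiset.esymm (ssytWeights [2, 2, 2, 2, 2, 1, 1] 8) 2 - 156 * esymm (Fin 8) ℤ 2
      ∈ Ideal.span {esymm (Fin 8) ℤ 1} := by
  have hW := Multiset.two_mul_esymm_two (ssytWeights shape 8)
  have hE := Multiset.two_mul_esymm_two
    ((Finset.univ : Finset (Fin 8)).val.map (X : Fin 8 → MvPolynomial (Fin 8) ℤ))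
  rw [← esymm_eq_multiset_esymm, Multiset.map_map] at hE
  change _ = (∑ v : Fin 8, X v) ^ 2 - ∑ v : Fin 8, X v ^ 2 at hE
  have hS := congrArg Multiset.sum ssytWeights_eq
  have hP := congrArg (fun s => (s.map (· ^ 2)).sum) ssytWeights_eq
  simp only [Multiset.map_coe, Multiset.sum_coe, List.map_map, Function.comp_def] at hS hP
  rw [hS, hP, sum_map_linear, sum_map_linear_sq] at hW
  have hQ : ∑ u, ∑ v, (((colsList.map fun p => mult p u * mult p v).sum : ℕ) :
      MvPolynomial (Fin 8) ℤ) * (X u * X v) =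
      831 * (∑ v : Fin 8, X v : MvPolynomial (Fin 8) ℤ) ^ 2 + 156 * ∑ v : Fin 8, X v ^ 2 := by
    have h (u v : Fin 8) : (((if u = v then 987 else 831 : ℕ)) : MvPolynomial (Fin 8) ℤ) *
        (X u * X v) = 831 * (X u * X v) + if u = v then 156 * (X u * X v) else 0 := by
      split_ifs <;> push_cast <;> ring
    simp only [sum_mult_mul_mult, h, Finset.sum_add_distrib, Finset.sum_ite_eq, Finset.mem_univ,
      if_true, sq, ← Finset.mul_sum, ← Finset.sum_mul]
  simp only [hQ, sum_mult, ← Finset.mul_sum] at hW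
  rw [esymm_one, Ideal.mem_span_singleton]
  refine ⟨160251 * ∑ v : Fin 8, X v, ?_⟩
  apply mul_left_cancel₀ (two_ne_zero : (2 : MvPolynomial (Fin 8) ℤ) ≠ 0)
  push_cast at hW
  linear_combination hW - 156 * hE
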